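/- Let k be a field, D a nonnegative integer, and e1, e2, e3 nonnegative integers such that e_i ≤ D for each i and e_i + e_j ≤ D whenever i ≠ j. Let R1, R2, R3 be nonzero homogeneous polynomials in two variables over k with R_i homogeneous of degree e_i. Then the k-vector space of triples (R'1, R'2, R'3), where each R'_i is a homogeneous polynomial of degree D − e_i in two variables over k (or zero) and R1·R'1 + R2·R'2 + R3·R'3 = 0, has dimension 2 + 2D − (e1 + e2 + e3) + deg(g), where g is any gcd of R1, R2, R3. -/

import Mathlib

open MvPolynomial

section LinearAlgebra

variable {K V W : Type*} [Field K] [AddCommGroup V] [Module K V] [AddCommGroup W] [Module K W]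

theorem Submodule.finrank_prod_eq (p : Submodule K V) (q : Submodule K W)
    [FiniteDimensional K p] [FiniteDimensional K q] :
    Module.finrank K (p.prod q) = Module.finrank K p + Module.finrank K q := by
  have h : p.prod q = LinearMap.range (p.subtype.prodMap q.subtype) := by
    simp [LinearMap.range_prodMap]
  rw [h, LinearMap.finrank_range_of_inj
    (Function.Injective.prodMap p.injective_subtype q.injective_subtype), Module.finrank_prod]

theorem Submodule.finite_prod (p : Submodule K V) (q : Submodule K W)
    [FiniteDimensional K p] [FiniteDimensional K q] : FiniteDimensional K (p.prod q) := by
  have h : p.prod q = LinearMap.range (p.subtype.prodMap q.subtype) := by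
    simp [LinearMap.range_prodMap]
  rw [h]
  infer_instance

theorem Submodule.finrank_map_add_finrank_inf_ker (f : V →ₗ[K] W) (p : Submodule K V)
    [FiniteDimensional K p] :
    Module.finrank K (p.map f) + Module.finrank K ↥(p ⊓ LinearMap.ker f) =
      Module.finrank K p := by
  have h := LinearMap.finrank_range_add_finrank_ker (f.domRestrict p)
  rw [LinearMap.range_domRestrict, LinearMap.ker_domRestrict] at h
  rw [← h, ← Submodule.map_comap_subtype,
    LinearEquiv.finrank_eq (Submodule.equivMapOfInjective _ p.injective_subtype _)]

end LinearAlgebra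

namespace MvPolynomial

section Factors

variable {σ R : Type*} [CommRing R]

theorem IsHomogeneous.le_order {p : MvPolynomial σ R} {n : ℕ} (hp : p.IsHomogeneous n) :
    (n : ℕ∞) ≤ (p : MvPowerSeries σ R).order := by
  refine MvPowerSeries.nat_le_order fun d hd => ?_
  rw [coeff_coe]
  exact hp.coeff_eq_zero hd.ne

theorem order_coe_le_totalDegree {p : MvPolynomial σ R} (hp : p ≠ 0) :
    (p : MvPowerSeries σ R).order ≤ p.totalDegree := by
  obtain ⟨d, hd⟩ := ne_zero_iff.mp hp
  refine (MvPowerSeries.order_le (d := d) (by rwa [coeff_coe])).trans ?_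
  exact_mod_cast le_totalDegree (mem_support_iff.mpr hd)

theorem isHomogeneous_of_totalDegree_le_order {p : MvPolynomial σ R}
    (h : (p.totalDegree : ℕ∞) ≤ (p : MvPowerSeries σ R).order) :
    p.IsHomogeneous p.totalDegree := by
  intro d hd
  refine (DFunLike.congr_fun (Finsupp.degree_eq_weight_one (R := ℕ)) d).symm.trans ?_
  refine le_antisymm (le_totalDegree (mem_support_iff.mpr hd)) ?_
  exact_mod_cast h.trans (MvPowerSeries.order_le (d := d) (by rwa [coeff_coe]))

variable [IsDomain R]

/-- A factor of a nonzero homogeneous polynomial over a domain is homogeneous. -/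
theorem IsHomogeneous.of_dvd {p q : MvPolynomial σ R} {n : ℕ} (hq : q.IsHomogeneous n)
    (hq0 : q ≠ 0) (h : p ∣ q) : p.IsHomogeneous p.totalDegree := by
  obtain ⟨r, rfl⟩ := h
  have hp0 := left_ne_zero_of_mul hq0
  have hr0 := right_ne_zero_of_mul hq0
  refine isHomogeneous_of_totalDegree_le_order ?_
  have hdeg := hq.totalDegree hq0
  rw [totalDegree_mul_of_isDomain hp0 hr0] at hdeg
  have hord := hq.le_order
  rw [coe_mul, MvPowerSeries.order_mul, ← hdeg] at hord
  have h1 := hord.trans (add_le_add_right (order_coe_le_totalDegree hr0) _)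
  push_cast at h1
  exact (ENat.add_le_add_iff_right (ENat.natCast_ne_top _)).mp h1

theorem IsHomogeneous.of_mul_left {p q : MvPolynomial σ R} {m n : ℕ} (hp : p.IsHomogeneous m)
    (hp0 : p ≠ 0) (h : (p * q).IsHomogeneous n) : q.IsHomogeneous (n - m) := by
  by_cases hq0 : q = 0
  · exact hq0 ▸ isHomogeneous_zero ..
  have hdeg := h.totalDegree (mul_ne_zero hp0 hq0)
  rw [totalDegree_mul_of_isDomain hp0 hq0, hp.totalDegree hp0] at hdeg
  rw [← hdeg, Nat.add_sub_cancel_left]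
  exact h.of_dvd (mul_ne_zero hp0 hq0) (dvd_mul_left q p)

end Factors

section Binary

variable {k : Type*} [Field k]

instance (n : ℕ) : FiniteDimensional k (homogeneousSubmodule (Fin 2) k n) :=
  Module.Finite.of_fg (homogeneousSubmodule_fg ..)

theorem finrank_homogeneousSubmodule_fin_two (n : ℕ) :
    Module.finrank k (homogeneousSubmodule (Fin 2) k n) = n + 1 := by
  have hs : {d : Fin 2 →₀ ℕ | d.degree = n} =
      ((Finset.univ : Finset (Fin 2)).finsuppAntidiag n : Set (Fin 2 →₀ ℕ)) := by
    ext d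
    simp [Finsupp.degree_eq_sum]
  rw [homogeneousSubmodule_eq_finsupp_supported, hs]
  refine (Module.finrank_eq_card_basis (basisRestrictSupport k
      ((Finset.univ : Finset (Fin 2)).finsuppAntidiag n : Set (Fin 2 →₀ ℕ)))).trans ?_
  simp [Finset.card_finsuppAntidiag_nat_eq_choose, add_comm 1 n]

/-- The homogeneous polynomials of degree `n` that are multiples of `p`. -/
noncomputable def homogeneousMultiples (p : MvPolynomial (Fin 2) k) (n : ℕ) :
    Submodule k (MvPolynomial (Fin 2) k) :=
  homogeneousSubmodule (Fin 2) k n ⊓ (Ideal.span {p}).restrictScalars k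

theorem mem_homogeneousMultiples {p q : MvPolynomial (Fin 2) k} {n : ℕ} :
    q ∈ homogeneousMultiples p n ↔ q.IsHomogeneous n ∧ p ∣ q := by
  simp [homogeneousMultiples, Ideal.mem_span_singleton]

instance (p : MvPolynomial (Fin 2) k) (n : ℕ) : FiniteDimensional k (homogeneousMultiples p n) :=
  Submodule.finiteDimensional_of_le inf_le_left

theorem map_mulLeft_homogeneousSubmodule {p : MvPolynomial (Fin 2) k} {m n : ℕ}
    (hp : p.IsHomogeneous m) (hp0 : p ≠ 0) (hmn : m ≤ n) :
    (homogeneousSubmodule (Fin 2) k (n - m)).map (LinearMap.mulLeft k p) =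
      homogeneousMultiples p n := by
  ext q
  rw [mem_homogeneousMultiples]
  constructor
  · rintro ⟨r, hr, rfl⟩
    refine ⟨?_, dvd_mul_right p r⟩
    simpa [Nat.add_sub_cancel' hmn] using hp.mul hr
  · rintro ⟨hq, r, rfl⟩
    exact ⟨r, hp.of_mul_left hp0 hq, rfl⟩

theorem finrank_homogeneousMultiples {p : MvPolynomial (Fin 2) k} {m n : ℕ}
    (hp : p.IsHomogeneous m) (hp0 : p ≠ 0) (hmn : m ≤ n) :
    Module.finrank k (homogeneousMultiples p n) = n - m + 1 := by
  rw [← map_mulLeft_homogeneousSubmodule hp hp0 hmn, 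
    ← LinearEquiv.finrank_eq (Submodule.equivMapOfInjective _ (mul_right_injective₀ hp0) _),
    finrank_homogeneousSubmodule_fin_two]

theorem homogeneousMultiples_mono {p q : MvPolynomial (Fin 2) k} (h : p ∣ q) (n : ℕ) :
    homogeneousMultiples q n ≤ homogeneousMultiples p n := by
  intro r
  simp only [mem_homogeneousMultiples]
  exact fun hr => ⟨hr.1, h.trans hr.2⟩

/-- In degrees at least the sum of the degrees of two binary forms, the ideal they generate agrees
with the ideal generated by their greatest common divisor. -/
theorem homogeneousMultiples_sup [GCDMonoid (MvPolynomial (Fin 2) k)]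
    {p q : MvPolynomial (Fin 2) k} {a b n : ℕ}
    (hp : p.IsHomogeneous a) (hq : q.IsHomogeneous b) (hp0 : p ≠ 0) (hq0 : q ≠ 0)
    (hn : a + b ≤ n) :
    homogeneousMultiples p n ⊔ homogeneousMultiples q n =
      homogeneousMultiples (gcd p q) n := by
  have hinf : homogeneousMultiples p n ⊓ homogeneousMultiples q n =
      homogeneousMultiples (lcm p q) n := by
    ext r
    simp only [Submodule.mem_inf, mem_homogeneousMultiples, lcm_dvd_iff]
    tauto
  have hg0 : gcd p q ≠ 0 := fun h => hp0 ((gcd_eq_zero_iff p q).mp h).1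
  have hl0 : lcm p q ≠ 0 := fun h => ((lcm_eq_zero_iff p q).mp h).elim hp0 hq0
  have hpq0 := mul_ne_zero hp0 hq0
  have hg := hp.of_dvd hp0 (gcd_dvd_left p q)
  have hl := (hp.mul hq).of_dvd hpq0 (lcm_dvd (dvd_mul_right p q) (dvd_mul_left q p))
  have hdeg : (gcd p q).totalDegree + (lcm p q).totalDegree = a + b := by
    have hassoc := gcd_mul_lcm p q
    rw [← totalDegree_mul_of_isDomain hg0 hl0, ← (hp.mul hq).totalDegree hpq0]
    exact le_antisymm (totalDegree_le_of_dvd_of_isDomain hassoc.dvd hpq0)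
      (totalDegree_le_of_dvd_of_isDomain hassoc.symm.dvd (mul_ne_zero hg0 hl0))
  refine Submodule.eq_of_le_of_finrank_eq (sup_le (homogeneousMultiples_mono (gcd_dvd_left p q) n)
    (homogeneousMultiples_mono (gcd_dvd_right p q) n)) ?_
  have h := Submodule.finrank_sup_add_finrank_inf_eq (homogeneousMultiples p n)
    (homogeneousMultiples q n)
  rw [hinf, finrank_homogeneousMultiples hp hp0 (by omega),
    finrank_homogeneousMultiples hq hq0 (by omega),
    finrank_homogeneousMultiples hl hl0 (by omega)] at h
  rw [finrank_homogeneousMultiples hg hg0 (by omega)]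
  omega

end Binary

end MvPolynomial

/-- Let `k` be a field, `D` a nonnegative integer and `e₁, e₂, e₃ ≤ D` with
`eᵢ + eⱼ ≤ D` for `i ≠ j`.  Let `R₁, R₂, R₃` be nonzero homogeneous polynomials in two variables
over `k`, with `Rᵢ` homogeneous of degree `eᵢ`, and let `g` be a gcd of `R₁, R₂, R₃`.  Then the
`k`-vector space of triples `(R₁', R₂', R₃')` of homogeneous polynomials (or zero) of degrees
`D - eᵢ` with `R₁R₁' + R₂R₂' + R₃R₃' = 0` has dimension
`2 + 2D - (e₁ + e₂ + e₃) + deg g`. -/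
theorem stmt_0 {k : Type*} [Field k] (D e1 e2 e3 : ℕ)
    (he1 : e1 ≤ D) (he2 : e2 ≤ D) (he3 : e3 ≤ D)
    (he12 : e1 + e2 ≤ D) (he13 : e1 + e3 ≤ D) (he23 : e2 + e3 ≤ D)
    (R1 R2 R3 : MvPolynomial (Fin 2) k)
    (hR1 : R1 ≠ 0) (hR2 : R2 ≠ 0) (hR3 : R3 ≠ 0)
    (hh1 : R1.IsHomogeneous e1) (hh2 : R2.IsHomogeneous e2) (hh3 : R3.IsHomogeneous e3)
    (g : MvPolynomial (Fin 2) k)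
    (hgdvd : g ∣ R1 ∧ g ∣ R2 ∧ g ∣ R3)
    (hgmax : ∀ p : MvPolynomial (Fin 2) k, p ∣ R1 → p ∣ R2 → p ∣ R3 → p ∣ g) :
    Module.finrank k
      ↥((homogeneousSubmodule (Fin 2) k (D - e1)).prod
          ((homogeneousSubmodule (Fin 2) k (D - e2)).prod
            (homogeneousSubmodule (Fin 2) k (D - e3))) ⊓
        LinearMap.ker
          ((LinearMap.mulLeft k R1 ∘ₗ
              LinearMap.fst k (MvPolynomial (Fin 2) k)
                (MvPolynomial (Fin 2) k × MvPolynomial (Fin 2) k)) +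
            (LinearMap.mulLeft k R2 ∘ₗ
              (LinearMap.fst k (MvPolynomial (Fin 2) k) (MvPolynomial (Fin 2) k) ∘ₗ
                LinearMap.snd k (MvPolynomial (Fin 2) k)
                  (MvPolynomial (Fin 2) k × MvPolynomial (Fin 2) k))) +
            (LinearMap.mulLeft k R3 ∘ₗ
              (LinearMap.snd k (MvPolynomial (Fin 2) k) (MvPolynomial (Fin 2) k) ∘ₗ
                LinearMap.snd k (MvPolynomial (Fin 2) k)
                  (MvPolynomial (Fin 2) k × MvPolynomial (Fin 2) k))))) =
      2 + 2 * D - (e1 + e2 + e3) + g.totalDegree := by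
  let _ : GCDMonoid (MvPolynomial (Fin 2) k) := UniqueFactorizationMonoid.toGCDMonoid _
  set f := (LinearMap.mulLeft k R1).coprod
    ((LinearMap.mulLeft k R2).coprod (LinearMap.mulLeft k R3)) with hf
  set S := (homogeneousSubmodule (Fin 2) k (D - e1)).prod
    ((homogeneousSubmodule (Fin 2) k (D - e2)).prod
      (homogeneousSubmodule (Fin 2) k (D - e3))) with hS
  have := Submodule.finite_prod (homogeneousSubmodule (Fin 2) k (D - e2))
    (homogeneousSubmodule (Fin 2) k (D - e3))
  have : FiniteDimensional k S := Submodule.finite_prod _ _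
  have hSrank : Module.finrank k S = (D - e1 + 1) + ((D - e2 + 1) + (D - e3 + 1)) := by
    rw [hS, Submodule.finrank_prod_eq, Submodule.finrank_prod_eq]
    simp only [finrank_homogeneousSubmodule_fin_two]
  have hh0 : gcd R1 R2 ≠ 0 := fun h => hR1 ((gcd_eq_zero_iff R1 R2).mp h).1
  have hh := hh1.of_dvd hR1 (gcd_dvd_left R1 R2)
  have hhdeg : (gcd R1 R2).totalDegree ≤ e1 :=
    (totalDegree_le_of_dvd_of_isDomain (gcd_dvd_left R1 R2) hR1).trans hh1.totalDegree_le
  have hg : g.IsHomogeneous g.totalDegree := hh1.of_dvd hR1 hgdvd.1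
  have hg0 : g ≠ 0 := ne_zero_of_dvd_ne_zero hR1 hgdvd.1
  have hgdeg : g.totalDegree ≤ e1 :=
    (totalDegree_le_of_dvd_of_isDomain hgdvd.1 hR1).trans hh1.totalDegree_le
  have hmap : S.map f = homogeneousMultiples g D := by
    rw [hS, hf, LinearMap.coprod_map_prod, LinearMap.coprod_map_prod,
      map_mulLeft_homogeneousSubmodule hh1 hR1 he1, map_mulLeft_homogeneousSubmodule hh2 hR2 he2,
      map_mulLeft_homogeneousSubmodule hh3 hR3 he3, ← sup_assoc,
      homogeneousMultiples_sup hh1 hh2 hR1 hR2 he12,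
      homogeneousMultiples_sup hh hh3 hh0 hR3 (by omega)]
    refine le_antisymm (homogeneousMultiples_mono ?_ D) (homogeneousMultiples_mono ?_ D)
    · exact dvd_gcd (dvd_gcd hgdvd.1 hgdvd.2.1) hgdvd.2.2
    · have hl := gcd_dvd_left (gcd R1 R2) R3
      exact hgmax _ (hl.trans (gcd_dvd_left R1 R2)) (hl.trans (gcd_dvd_right R1 R2))
        (gcd_dvd_right (gcd R1 R2) R3)
  have hrank := Submodule.finrank_map_add_finrank_inf_ker f S
  rw [hmap, finrank_homogeneousMultiples hg hg0 (hgdeg.trans he1), hSrank] at hrank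
  trans Module.finrank k ↥(S ⊓ LinearMap.ker f)
  · refine congrArg (fun T : Submodule k (MvPolynomial (Fin 2) k × MvPolynomial (Fin 2) k ×
      MvPolynomial (Fin 2) k) => Module.finrank k T) (Submodule.ext fun x => ?_)
    simp [hf, LinearMap.mem_ker, add_assoc]
  · omega
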